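/- arXiv:2004.07065 — 2 statements merged into one kernel-verified Lean document; each statement's English description precedes it below -/
import Mathlib

section
/- Let n, k ≥ 1 be integers, let 0 < t₁ < t₂ < ⋯ < t_k be real numbers, and let f : (ℝⁿ)^k → ℝ be a measurable function for which there exist constants C > 0 and a ≥ 0 with 0 < f(y) ≤ C·exp(a‖y‖) for all y ∈ (ℝⁿ)^k. Then the function ψ_f : (ℝⁿ)^k → ℝ defined by ψ_f(x₁,…,x_k) = ln H_{t₁,…,t_k}f(x₁,…,x_k) + ‖x₁‖²/(4t₁) + ‖x₂−x₁‖²/(4(t₂−t₁)) + ⋯ + ‖x_k−x_{k−1}‖²/(4(t_k−t_{k−1})) is convex on (ℝⁿ)^k. -/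
open MeasureTheory Real

/-- The heat kernel on `ℝⁿ`, normalized so that the generator is the Laplacian. -/
noncomputable def heatKernel (n : ℕ) (t : ℝ) (x y : EuclideanSpace ℝ (Fin n)) : ℝ :=
  (4 * Real.pi * t) ^ (-(n : ℝ) / 2) * Real.exp (-‖x - y‖ ^ 2 / (4 * t))

/-- For a tuple indexed by `Fin k`, the previous value with the convention that the value at
index `0` is `0` (i.e. `x_{j-1}`, with `x₀ = 0`). -/
def prevVal {k : ℕ} {α : Type*} [Zero α] (x : Fin k → α) (j : Fin k) : α :=
  if _ : (j : ℕ) = 0 then 0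
  else x ⟨(j : ℕ) - 1, lt_of_le_of_lt (Nat.sub_le _ _) j.isLt⟩

/-- The density `(y₁,…,y_k) ↦ ρ_{t₁}(0,y₁)·ρ_{t₂−t₁}(y₁,y₂)⋯ρ_{t_k−t_{k−1}}(y_{k−1},y_k)` of
the product heat kernel measure on `(ℝⁿ)^k`. -/
noncomputable def heatDensity (n k : ℕ) (t : Fin k → ℝ)
    (y : Fin k → EuclideanSpace ℝ (Fin n)) : ℝ :=
  ∏ j : Fin k, heatKernel n (t j - prevVal t j) (prevVal y j) (y j)

/-- The product heat kernel measure `μ` on `(ℝⁿ)^k` for times `0 < t₁ < ⋯ < t_k`. -/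
noncomputable def heatMeasure (n k : ℕ) (t : Fin k → ℝ) :
    Measure (Fin k → EuclideanSpace ℝ (Fin n)) :=
  MeasureTheory.volume.withDensity (fun y => ENNReal.ofReal (heatDensity n k t y))

theorem integral_pos_of_forall_pos {Ω : Type*} [MeasurableSpace Ω] {μ : Measure Ω} [NeZero μ]
    {g : Ω → ℝ} (hpos : ∀ ω, 0 < g ω) (hint : Integrable g μ) : 0 < ∫ ω, g ω ∂μ := by
  rw [integral_pos_iff_support_of_nonneg (fun ω => (hpos ω).le) hint,
    Function.support_eq_univ fun ω => (hpos ω).ne']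
  exact Measure.measure_univ_pos.2 (NeZero.ne μ)

theorem convexOn_log_integral {E Ω : Type*} [AddCommGroup E] [Module ℝ E] [MeasurableSpace Ω]
    {μ : Measure Ω} [NeZero μ] {F : E → Ω → ℝ} (hpos : ∀ x ω, 0 < F x ω)
    (hint : ∀ x, Integrable (F x) μ)
    (hconv : ∀ ω, ConvexOn ℝ Set.univ (fun x => Real.log (F x ω))) :
    ConvexOn ℝ Set.univ (fun x => Real.log (∫ ω, F x ω ∂μ)) := by
  have hI (x : E) : 0 < ∫ ω, F x ω ∂μ := integral_pos_of_forall_pos (hpos x) (hint x)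
  refine ⟨convex_univ, fun x _ y _ α β hα hβ hαβ => ?_⟩
  set A := ∫ ω, F x ω ∂μ with hA
  set B := ∫ ω, F y ω ∂μ with hB
  set K := Real.exp (α * Real.log A + β * Real.log B) with hK
  have hpt (ω : Ω) : F (α • x + β • y) ω ≤ K * (α / A * F x ω + β / B * F y ω) := by
    have h1 := (hconv ω).2 (Set.mem_univ x) (Set.mem_univ y) hα hβ hαβ
    have h2 := convexOn_exp.2 (Set.mem_univ (Real.log (F x ω) - Real.log A))
      (Set.mem_univ (Real.log (F y ω) - Real.log B)) hα hβ hαβ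
    simp only [smul_eq_mul] at h1 h2
    rw [Real.exp_sub, Real.exp_sub, Real.exp_log (hpos x ω), Real.exp_log (hpos y ω),
      Real.exp_log (hI x), Real.exp_log (hI y)] at h2
    calc F (α • x + β • y) ω
        = Real.exp (Real.log (F (α • x + β • y) ω)) := (Real.exp_log (hpos _ ω)).symm
      _ ≤ Real.exp (α * Real.log (F x ω) + β * Real.log (F y ω)) := Real.exp_le_exp.2 h1
      _ = K * Real.exp (α * (Real.log (F x ω) - Real.log A)
            + β * (Real.log (F y ω) - Real.log B)) := by
          rw [hK, ← Real.exp_add]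
          ring_nf
      _ ≤ K * (α * (F x ω / A) + β * (F y ω / B)) := by gcongr
      _ = K * (α / A * F x ω + β / B * F y ω) := by ring
  have hle : ∫ ω, F (α • x + β • y) ω ∂μ ≤ K := by
    calc ∫ ω, F (α • x + β • y) ω ∂μ
        ≤ ∫ ω, K * (α / A * F x ω + β / B * F y ω) ∂μ :=
          integral_mono (hint _)
            ((((hint x).const_mul _).add ((hint y).const_mul _)).const_mul _) hpt
      _ = K * (α / A * A + β / B * B) := by
          rw [integral_const_mul, integral_add ((hint x).const_mul _) ((hint y).const_mul _),
            integral_const_mul, integral_const_mul]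
      _ = K := by
          rw [div_mul_cancel₀ _ (hI x).ne', div_mul_cancel₀ _ (hI y).ne', hαβ, mul_one]
  simp only [smul_eq_mul]
  rw [Real.log_le_iff_le_exp (hI _)]
  exact hle

section PrevVal

variable {k : ℕ} {V : Type*}

theorem prevVal_sub [AddGroup V] (x y : Fin k → V) (j : Fin k) :
    prevVal (x - y) j = prevVal x j - prevVal y j := by
  unfold prevVal
  split_ifs <;> simp

theorem prevVal_add [AddZeroClass V] (x y : Fin k → V) (j : Fin k) :
    prevVal (x + y) j = prevVal x j + prevVal y j := by
  unfold prevVal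
  split_ifs <;> simp

theorem prevVal_smul [AddCommGroup V] [Module ℝ V] (c : ℝ) (x : Fin k → V) (j : Fin k) :
    prevVal (c • x) j = c • prevVal x j := by
  unfold prevVal
  split_ifs <;> simp

theorem continuous_prevVal [TopologicalSpace V] [Zero V] (j : Fin k) :
    Continuous fun x : Fin k → V => prevVal x j := by
  unfold prevVal
  split_ifs <;> fun_prop

theorem norm_le_sum_norm_sub_prevVal [SeminormedAddCommGroup V] (x : Fin k → V) :
    ‖x‖ ≤ ∑ i, ‖x i - prevVal x i‖ := by
  have key (m : ℕ) (hm : m < k) :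
      ‖x ⟨m, hm⟩‖ ≤ ∑ i ∈ Finset.Iic (⟨m, hm⟩ : Fin k), ‖x i - prevVal x i‖ := by
    induction m with
    | zero =>
      refine le_trans (le_of_eq ?_) (Finset.single_le_sum
        (f := fun i => ‖x i - prevVal x i‖) (fun i _ => norm_nonneg _)
        (Finset.mem_Iic.2 (le_refl (⟨0, hm⟩ : Fin k))))
      simp [prevVal]
    | succ m ih =>
      have hsub : insert (⟨m + 1, hm⟩ : Fin k) (Finset.Iic ⟨m, by omega⟩)
          ⊆ Finset.Iic (⟨m + 1, hm⟩ : Fin k) := by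
        intro i
        simp only [Finset.mem_insert, Finset.mem_Iic, Fin.le_def, Fin.ext_iff]
        omega
      refine le_trans ?_ (Finset.sum_le_sum_of_subset_of_nonneg hsub
        fun i _ _ => norm_nonneg _)
      rw [Finset.sum_insert (by simp [Fin.le_def])]
      have hp : prevVal x ⟨m + 1, hm⟩ = x ⟨m, by omega⟩ := by simp [prevVal]
      rw [hp]
      have := norm_le_norm_sub_add (x ⟨m + 1, hm⟩) (x ⟨m, by omega⟩)
      linarith [ih (by omega)]
  rw [pi_norm_le_iff_of_nonneg (Finset.sum_nonneg fun i _ => norm_nonneg _)]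
  exact fun j => (key j j.2).trans
    (Finset.sum_le_sum_of_subset_of_nonneg (Finset.subset_univ _) fun i _ _ => norm_nonneg _)

theorem sub_prevVal_pos {t : Fin k → ℝ} (hmono : StrictMono t) (hpos : ∀ j, 0 < t j)
    (j : Fin k) : 0 < t j - prevVal t j := by
  unfold prevVal
  split_ifs with h
  · simpa using hpos j
  · exact sub_pos.2 (hmono (by simp only [Fin.lt_def]; omega))

end PrevVal

/-- The quadratic form `Σ_j ‖x_j − x_{j−1}‖² / (4 (t_j − t_{j−1}))`. -/
noncomputable def heatEnergy {n k : ℕ} (t : Fin k → ℝ)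
    (x : Fin k → EuclideanSpace ℝ (Fin n)) : ℝ :=
  ∑ j : Fin k, ‖x j - prevVal x j‖ ^ 2 / (4 * (t j - prevVal t j))

section HeatEnergy

variable {n k : ℕ} {t : Fin k → ℝ}

theorem convexOn_heatEnergy_sub (t : Fin k → ℝ) (z : Fin k → EuclideanSpace ℝ (Fin n)) :
    ConvexOn ℝ Set.univ fun x => heatEnergy t x - heatEnergy t (z - x) := by
  have h (x : Fin k → EuclideanSpace ℝ (Fin n)) : heatEnergy t x - heatEnergy t (z - x) =
      ∑ j : Fin k, (2 * inner ℝ (z j - prevVal z j) (x j - prevVal x j)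
        - ‖z j - prevVal z j‖ ^ 2) / (4 * (t j - prevVal t j)) := by
    rw [heatEnergy, heatEnergy, ← Finset.sum_sub_distrib]
    refine Finset.sum_congr rfl fun j _ => ?_
    rw [prevVal_sub, Pi.sub_apply, sub_sub_sub_comm,
      norm_sub_sq_real (z j - prevVal z j)]
    ring
  refine ⟨convex_univ, fun x _ y _ α β _ _ hαβ => le_of_eq ?_⟩
  simp only [h, smul_eq_mul, Finset.mul_sum]
  rw [← Finset.sum_add_distrib]
  refine Finset.sum_congr rfl fun j _ => ?_
  have hd : (α • x + β • y) j - prevVal (α • x + β • y) j =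
      α • (x j - prevVal x j) + β • (y j - prevVal y j) := by
    rw [prevVal_add, prevVal_smul, prevVal_smul]
    simp only [Pi.add_apply, Pi.smul_apply, smul_sub]
    abel
  rw [hd, inner_add_right, inner_smul_right, inner_smul_right]
  obtain rfl : β = 1 - α := by linarith
  ring

theorem exists_heatDensity_eq (n : ℕ) (hs : ∀ j, 0 < t j - prevVal t j) :
    ∃ c : ℝ, 0 < c ∧ ∀ y : Fin k → EuclideanSpace ℝ (Fin n),
      heatDensity n k t y = c * Real.exp (-heatEnergy t y) := by
  refine ⟨∏ j : Fin k, (4 * Real.pi * (t j - prevVal t j)) ^ (-(n : ℝ) / 2),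
    Finset.prod_pos fun j _ => ?_, fun y => ?_⟩
  · have := hs j
    positivity
  · simp only [heatDensity, heatKernel, Finset.prod_mul_distrib, ← Real.exp_sum, heatEnergy,
      neg_div, Finset.sum_neg_distrib]
    simp only [norm_sub_rev]

theorem continuous_heatEnergy : Continuous (heatEnergy (n := n) t) := by
  have (j : Fin k) := continuous_prevVal (V := EuclideanSpace ℝ (Fin n)) j
  unfold heatEnergy
  fun_prop

theorem exists_sq_norm_le_mul_heatEnergy (n : ℕ) (hs : ∀ j, 0 < t j - prevVal t j) :
    ∃ M : ℝ, 0 < M ∧ ∀ y : Fin k → EuclideanSpace ℝ (Fin n),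
      ‖y‖ ^ 2 ≤ M * heatEnergy t y := by
  set S := ∑ j, 4 * (t j - prevVal t j)
  have hS : 0 ≤ S := Finset.sum_nonneg fun j _ => by linarith [hs j]
  have hE (y : Fin k → EuclideanSpace ℝ (Fin n)) : 0 ≤ heatEnergy t y :=
    Finset.sum_nonneg fun j _ => by have := hs j; positivity
  refine ⟨k * S + 1, by positivity, fun y => ?_⟩
  calc ‖y‖ ^ 2 ≤ (∑ i, ‖y i - prevVal y i‖) ^ 2 := by
        gcongr
        exact norm_le_sum_norm_sub_prevVal y
    _ ≤ k * ∑ i, ‖y i - prevVal y i‖ ^ 2 := by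
        simpa using sq_sum_le_card_mul_sum_sq (s := Finset.univ)
          (f := fun i => ‖y i - prevVal y i‖)
    _ ≤ k * (S * heatEnergy t y) := by
        rw [heatEnergy, Finset.mul_sum (a := S)]
        gcongr with i
        have hi := hs i
        calc ‖y i - prevVal y i‖ ^ 2 = (4 * (t i - prevVal t i)) *
              (‖y i - prevVal y i‖ ^ 2 / (4 * (t i - prevVal t i))) := by field_simp
          _ ≤ S * (‖y i - prevVal y i‖ ^ 2 / (4 * (t i - prevVal t i))) := by
            gcongr
            exact Finset.single_le_sum (f := fun j => 4 * (t j - prevVal t j))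
              (fun j _ => by linarith [hs j]) (Finset.mem_univ i)
    _ ≤ (k * S + 1) * heatEnergy t y := by linarith [hE y]

theorem integrable_exp_neg_mul_sq_norm_pi {b : ℝ} (hb : 0 < b) :
    Integrable fun y : Fin k → EuclideanSpace ℝ (Fin n) => Real.exp (-b * ‖y‖ ^ 2) := by
  rcases Nat.eq_zero_or_pos k with rfl | hk
  · exact .of_finite
  have hk' : (0 : ℝ) < k := by exact_mod_cast hk
  have h1 : Integrable fun v : EuclideanSpace ℝ (Fin n) => Real.exp (-(b / k) * ‖v‖ ^ 2) := by
    have := (GaussianFourier.integrable_cexp_neg_mul_sq_norm_add (b := (b / k : ℝ))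
      (by simpa using (by positivity : 0 < b / k)) 0 (0 : EuclideanSpace ℝ (Fin n))).norm
    simpa [Complex.norm_exp, ← Complex.ofReal_pow, ← Complex.ofReal_div, ← Complex.ofReal_neg,
      ← Complex.ofReal_mul] using this
  have h2 := Integrable.fintype_prod (ι := Fin k) (fun _ => h1)
  refine h2.mono' (by fun_prop) (.of_forall fun y => ?_)
  rw [Real.norm_of_nonneg (Real.exp_nonneg _), ← Real.exp_sum, Real.exp_le_exp,
    ← Finset.mul_sum]
  have : ∑ i, ‖y i‖ ^ 2 ≤ k * ‖y‖ ^ 2 := by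
    calc ∑ i, ‖y i‖ ^ 2 ≤ ∑ _i : Fin k, ‖y‖ ^ 2 := by
          gcongr with i
          exact norm_le_pi_norm y i
      _ = k * ‖y‖ ^ 2 := by simp
  have h3 : b / k * ∑ i, ‖y i‖ ^ 2 ≤ b / k * (k * ‖y‖ ^ 2) := by gcongr
  have h4 : b / k * (k * ‖y‖ ^ 2) = b * ‖y‖ ^ 2 := by field_simp
  linarith

theorem integrable_mul_exp_neg_heatEnergy_sub (hs : ∀ j, 0 < t j - prevVal t j)
    {f : (Fin k → EuclideanSpace ℝ (Fin n)) → ℝ} (hf : Measurable f) {C a : ℝ} (hC : 0 ≤ C)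
    (ha : 0 ≤ a) (hgrowth : ∀ y, |f y| ≤ C * Real.exp (a * ‖y‖))
    (x : Fin k → EuclideanSpace ℝ (Fin n)) :
    Integrable fun z => f z * Real.exp (-heatEnergy t (z - x)) := by
  obtain ⟨M, hM, hcoer⟩ := exists_sq_norm_le_mul_heatEnergy n hs
  have hcont : Continuous (heatEnergy (n := n) t) := continuous_heatEnergy
  have hdom : Integrable fun z : Fin k → EuclideanSpace ℝ (Fin n) =>
      C * Real.exp (a * ‖x‖ + a ^ 2 * M / 2) * Real.exp (-(1 / (2 * M)) * ‖z - x‖ ^ 2) :=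
    ((integrable_exp_neg_mul_sq_norm_pi (by positivity)).comp_sub_right x).const_mul _
  refine hdom.mono' (by fun_prop) (.of_forall fun z => ?_)
  rw [norm_mul, Real.norm_eq_abs, Real.norm_of_nonneg (Real.exp_nonneg _)]
  calc |f z| * Real.exp (-heatEnergy t (z - x))
      ≤ C * Real.exp (a * ‖z‖) * Real.exp (-heatEnergy t (z - x)) := by
        gcongr
        exact hgrowth z
    _ = C * Real.exp (a * ‖z‖ - heatEnergy t (z - x)) := by
        rw [mul_assoc, ← Real.exp_add, ← sub_eq_add_neg]
    _ ≤ C * Real.exp (a * ‖x‖ + a ^ 2 * M / 2 + -(1 / (2 * M)) * ‖z - x‖ ^ 2) := by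
        gcongr
        have h1 : a * ‖z‖ ≤ a * (‖z - x‖ + ‖x‖) := by
          gcongr
          exact norm_le_norm_sub_add z x
        have h2 : ‖z - x‖ ^ 2 / M ≤ heatEnergy t (z - x) := by
          rw [div_le_iff₀ hM, mul_comm]
          exact hcoer _
        have h3 : a ^ 2 * M / 2 - a * ‖z - x‖ + ‖z - x‖ ^ 2 / M / 2
            = (a * M - ‖z - x‖) ^ 2 / (2 * M) := by
          field_simp
          ring
        have h4 : 0 ≤ (a * M - ‖z - x‖) ^ 2 / (2 * M) := by positivity
        have h5 : -(1 / (2 * M)) * ‖z - x‖ ^ 2 = -(‖z - x‖ ^ 2 / M / 2) := by field_simp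
        linarith
    _ = _ := by rw [Real.exp_add (_ + _), mul_assoc]

theorem integral_heatMeasure_add_right {c : ℝ} (hc : 0 < c)
    (hdens : ∀ y : Fin k → EuclideanSpace ℝ (Fin n),
      heatDensity n k t y = c * Real.exp (-heatEnergy t y))
    (f : (Fin k → EuclideanSpace ℝ (Fin n)) → ℝ) (x : Fin k → EuclideanSpace ℝ (Fin n)) :
    ∫ y, f (y + x) ∂(heatMeasure n k t) =
      c * ∫ z, f z * Real.exp (-heatEnergy t (z - x)) := by
  have hcont : Continuous (heatEnergy (n := n) t) := continuous_heatEnergy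
  rw [heatMeasure, integral_withDensity_eq_integral_toReal_smul
    (by simp only [hdens]; fun_prop) (.of_forall fun _ => ENNReal.ofReal_lt_top),
    ← integral_const_mul,
    ← integral_add_right_eq_self (fun z => c * (f z * Real.exp (-heatEnergy t (z - x)))) x]
  refine integral_congr_ae (.of_forall fun y => ?_)
  have : 0 ≤ c * Real.exp (-heatEnergy t y) := by positivity
  simp only [hdens, ENNReal.toReal_ofReal this, smul_eq_mul, add_sub_cancel_right]
  ring

end HeatEnergy

/-- convexity of `ψ_f = ln H_{t₁,…,t_k} f + Σ_j ‖x_j − x_{j−1}‖²/(4(t_j − t_{j−1}))`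
for positive measurable `f` of at most exponential growth. -/
theorem generalized_heat_flow_log_convexity
    (n k : ℕ) (hn : 1 ≤ n) (hk : 1 ≤ k)
    (t : Fin k → ℝ) (hmono : StrictMono t) (hpos : ∀ j, 0 < t j)
    (f : (Fin k → EuclideanSpace ℝ (Fin n)) → ℝ) (hf : Measurable f)
    (C a : ℝ) (hC : 0 < C) (ha : 0 ≤ a)
    (hgrowth : ∀ y, 0 < f y ∧ f y ≤ C * Real.exp (a * ‖y‖)) :
    ConvexOn ℝ Set.univ (fun x : Fin k → EuclideanSpace ℝ (Fin n) =>
      Real.log (∫ y, f (fun j => y j + x j) ∂(heatMeasure n k t)) +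
      ∑ j : Fin k, ‖x j - prevVal x j‖ ^ 2 / (4 * (t j - prevVal t j))) := by
  have hs := sub_prevVal_pos hmono hpos
  obtain ⟨c, hc, hdens⟩ := exists_heatDensity_eq n hs
  set F : (Fin k → EuclideanSpace ℝ (Fin n)) → (Fin k → EuclideanSpace ℝ (Fin n)) → ℝ :=
    fun x z => c * Real.exp (heatEnergy t x) * (f z * Real.exp (-heatEnergy t (z - x))) with hF
  have hFpos x z : 0 < F x z := by
    have := (hgrowth z).1
    positivity
  have hint x : Integrable (F x) :=
    (integrable_mul_exp_neg_heatEnergy_sub hs hf hC.le ha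
      (fun y => by simpa only [abs_of_pos (hgrowth y).1] using (hgrowth y).2) x).const_mul _
  have hconv z : ConvexOn ℝ Set.univ fun x => Real.log (F x z) := by
    have hlog : (fun x => Real.log (F x z)) = fun x =>
        (heatEnergy t x - heatEnergy t (z - x)) + (Real.log c + Real.log (f z)) := by
      ext x
      have := (hgrowth z).1
      rw [hF, Real.log_mul (by positivity) (by positivity), Real.log_mul (by positivity)
        (by positivity), Real.log_mul (by positivity) (by positivity), Real.log_exp, Real.log_exp]
      ring
    rw [hlog]
    exact (convexOn_heatEnergy_sub t z).add_const _
  refine (convexOn_log_integral hFpos hint hconv).congr fun x _ => ?_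
  have hx : ∫ z, F x z = Real.exp (heatEnergy t x) * ∫ y, f (y + x) ∂(heatMeasure n k t) := by
    rw [integral_heatMeasure_add_right hc hdens, hF, integral_const_mul]
    ring
  have hne : ∫ y, f (y + x) ∂(heatMeasure n k t) ≠ 0 := by
    have := integral_pos_of_forall_pos (hFpos x) (hint x)
    rw [hx] at this
    exact (pos_of_mul_pos_right this (Real.exp_nonneg _)).ne'
  change Real.log (∫ z, F x z) =
    Real.log (∫ y, f (y + x) ∂(heatMeasure n k t)) + heatEnergy t x
  rw [hx, Real.log_mul (Real.exp_pos _).ne' hne, Real.log_exp, add_comm]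
end

section
/- Let n ≥ 1 and let f : ℝⁿ → [0,∞) be a bounded measurable function which is not Lebesgue-almost everywhere zero. For t > 0 define f_t(x) = ∫_{ℝⁿ} (4πt)^{−n/2}·exp(−‖x−y‖²/(4t))·f(y) dy. Then f_t is smooth and strictly positive, and for every t > 0 and every x ∈ ℝⁿ one has the Li–Yau differential Harnack inequality Δf_t(x)/f_t(x) − ‖∇f_t(x)‖²/f_t(x)² + n/(2t) ≥ 0. -/
open MeasureTheory Real

/-- The heat flow `f_t(x) = ∫ (4πt)^{-n/2} exp(-‖x-y‖²/(4t)) f(y) dy` on `ℝⁿ`. -/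
noncomputable def heatFlow (n : ℕ) (f : EuclideanSpace ℝ (Fin n) → ℝ) (t : ℝ)
    (x : EuclideanSpace ℝ (Fin n)) : ℝ :=
  ∫ y, (4 * Real.pi * t) ^ (-(n : ℝ) / 2) * Real.exp (-‖x - y‖ ^ 2 / (4 * t)) * f y

/-- The Laplacian of a function on `ℝⁿ`, as the trace of its Hessian in the standard
orthonormal basis. -/
noncomputable def laplacian (n : ℕ) (g : EuclideanSpace ℝ (Fin n) → ℝ)
    (x : EuclideanSpace ℝ (Fin n)) : ℝ :=
  ∑ i : Fin n, iteratedFDeriv ℝ 2 g x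
    ![EuclideanSpace.single i (1 : ℝ), EuclideanSpace.single i (1 : ℝ)]

section LaplaceTransform

variable {E F : Type} [NormedAddCommGroup E] [InnerProductSpace ℝ E]
  [NormedAddCommGroup F] [NormedSpace ℝ F]

lemma exp_mul_inner_le (c : ℝ) (y x : E) {r : ℝ} (hr : ‖x‖ ≤ r) :
    Real.exp (c * inner ℝ y x) ≤ Real.exp (|c| * r * ‖y‖) := by
  apply Real.exp_le_exp.2
  calc c * inner ℝ y x ≤ |c * inner ℝ y x| := le_abs_self _
    _ = |c| * |inner ℝ y x| := abs_mul _ _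
    _ ≤ |c| * (‖y‖ * ‖x‖) := by gcongr; exact abs_real_inner_le_norm y x
    _ ≤ |c| * (‖y‖ * r) := by gcongr
    _ = _ := by ring

variable [MeasurableSpace E]

/-- The measurable function `g` is integrable against every exponential weight `exp (R‖y‖)`. -/
def ExpIntegrable (μ : Measure E) (g : E → F) : Prop :=
  AEStronglyMeasurable g μ ∧ ∀ R : ℝ, Integrable (fun y => Real.exp (R * ‖y‖) * ‖g y‖) μ

/-- The (rescaled) Laplace transform `x ↦ ∫ exp (c⟪y, x⟫) g(y) dμ(y)`. -/
noncomputable def laplaceTransform (μ : Measure E) (c : ℝ) (g : E → F) (x : E) : F :=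
  ∫ y, Real.exp (c * inner ℝ y x) • g y ∂μ

variable [BorelSpace E] {μ : Measure E}

lemma ExpIntegrable.integrable {g : E → F} (hg : ExpIntegrable μ g) (c : ℝ) (x : E) :
    Integrable (fun y => Real.exp (c * inner ℝ y x) • g y) μ := by
  refine (hg.2 (|c| * ‖x‖)).mono' ?_ (.of_forall fun y => ?_)
  · exact (Continuous.aestronglyMeasurable (by fun_prop)).smul hg.1
  · rw [norm_smul, Real.norm_of_nonneg (Real.exp_pos _).le]
    exact mul_le_mul_of_nonneg_right (exp_mul_inner_le c y x le_rfl) (norm_nonneg _)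

variable [SecondCountableTopology E]

lemma ExpIntegrable.smulRight {g : E → F} (hg : ExpIntegrable μ g) (c : ℝ) :
    ExpIntegrable μ (fun y => c • (innerSL ℝ y).smulRight (g y)) := by
  have hmeas : AEStronglyMeasurable (fun y => c • (innerSL ℝ y).smulRight (g y)) μ := by
    refine AEStronglyMeasurable.const_smul ?_ c
    have h1 : AEStronglyMeasurable (fun y : E => innerSL ℝ y) μ :=
      Continuous.aestronglyMeasurable (by fun_prop)
    exact (ContinuousLinearMap.smulRightL ℝ E F).continuous₂.comp_aestronglyMeasurable₂ h1 hg.1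
  refine ⟨hmeas, fun R => ((hg.2 (R + 1)).const_mul |c|).mono' ?_ (.of_forall fun y => ?_)⟩
  · exact (Continuous.aestronglyMeasurable (by fun_prop)).mul hmeas.norm
  · rw [norm_mul, norm_norm, Real.norm_of_nonneg (Real.exp_pos _).le, norm_smul,
      ContinuousLinearMap.norm_smulRight_apply, innerSL_apply_norm, Real.norm_eq_abs, add_mul,
      Real.exp_add, one_mul]
    have : ‖y‖ ≤ Real.exp ‖y‖ := by linarith [Real.add_one_le_exp ‖y‖]
    calc _ = |c| * (Real.exp (R * ‖y‖) * ‖y‖ * ‖g y‖) := by ring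
      _ ≤ _ := by gcongr

lemma ExpIntegrable.inner_mul {g : E → ℝ} (hg : ExpIntegrable μ g) (c : ℝ) (v : E) :
    ExpIntegrable μ (fun y => c * inner ℝ y v * g y) := by
  have hmeas : AEStronglyMeasurable (fun y => c * inner ℝ y v * g y) μ :=
    (Continuous.aestronglyMeasurable (by fun_prop)).mul hg.1
  refine ⟨hmeas, fun R => (((hg.smulRight c).2 R).mul_const ‖v‖).mono' ?_ (.of_forall fun y => ?_)⟩
  · exact (Continuous.aestronglyMeasurable (by fun_prop)).mul hmeas.norm
  · rw [norm_mul, norm_norm, Real.norm_of_nonneg (Real.exp_pos _).le, mul_assoc]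
    gcongr
    have := (c • (innerSL ℝ y).smulRight (g y)).le_opNorm v
    simpa [mul_assoc] using this

lemma ExpIntegrable.hasFDerivAt_laplaceTransform {g : E → F} (hg : ExpIntegrable μ g) (c : ℝ)
    (x : E) :
    HasFDerivAt (laplaceTransform μ c g)
      (laplaceTransform μ c (fun y => c • (innerSL ℝ y).smulRight (g y)) x) x := by
  have hg' := hg.smulRight c
  refine hasFDerivAt_integral_of_dominated_of_fderiv_le
    (bound := fun y => Real.exp (|c| * (‖x‖ + 1) * ‖y‖) * ‖c • (innerSL ℝ y).smulRight (g y)‖)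
    (F' := fun z y => Real.exp (c * inner ℝ y z) • (c • (innerSL ℝ y).smulRight (g y)))
    (Metric.ball_mem_nhds x one_pos)
    (.of_forall fun z => (hg.integrable c z).aestronglyMeasurable) (hg.integrable c x)
    (hg'.integrable c x).aestronglyMeasurable (.of_forall fun y z hz => ?_) (hg'.2 _)
    (.of_forall fun y z _ => ?_)
  · rw [norm_smul, Real.norm_of_nonneg (Real.exp_pos _).le]
    refine mul_le_mul_of_nonneg_right (exp_mul_inner_le c y z ?_) (norm_nonneg _)
    have := norm_le_norm_add_norm_sub' z x
    rw [mem_ball_iff_norm] at hz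
    linarith
  · have h : HasFDerivAt (fun z => Real.exp (c * inner ℝ y z))
        (Real.exp (c * inner ℝ y z) • (c • innerSL ℝ y)) z :=
      (((innerSL ℝ y).hasFDerivAt (x := z)).const_mul c).exp
    convert! h.smul_const (g y) using 1
    ext v
    simp [mul_smul]

lemma ExpIntegrable.contDiff_laplaceTransform {g : E → F} (hg : ExpIntegrable μ g) (c : ℝ) :
    ContDiff ℝ (⊤ : ℕ∞) (laplaceTransform μ c g) := by
  refine contDiff_infty.2 fun m => ?_
  induction m generalizing F with
  | zero =>
    exact contDiff_zero.2
      (continuous_iff_continuousAt.2 fun x => (hg.hasFDerivAt_laplaceTransform c x).continuousAt)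
  | succ m ih =>
    exact contDiff_succ_iff_hasFDerivAt.2
      ⟨_, ih (hg.smulRight c), hg.hasFDerivAt_laplaceTransform c⟩

lemma ExpIntegrable.fderiv_laplaceTransform_apply {g : E → ℝ} (hg : ExpIntegrable μ g) (c : ℝ)
    (x v : E) :
    fderiv ℝ (laplaceTransform μ c g) x v =
      laplaceTransform μ c (fun y => c * inner ℝ y v * g y) x := by
  rw [(hg.hasFDerivAt_laplaceTransform c x).fderiv, laplaceTransform,
    ContinuousLinearMap.integral_apply ((hg.smulRight c).integrable c x)]
  simp [laplaceTransform, mul_assoc]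

/-- Log-convexity of the Laplace transform of a nonnegative density, in infinitesimal form. -/
lemma ExpIntegrable.sq_laplaceTransform_le {g : E → ℝ} (hg : ExpIntegrable μ g)
    (hg0 : ∀ y, 0 ≤ g y) (c : ℝ) (x v : E) (hpos : 0 < laplaceTransform μ c g x) :
    laplaceTransform μ c (fun y => c * inner ℝ y v * g y) x ^ 2 ≤
      laplaceTransform μ c (fun y => c * inner ℝ y v * (c * inner ℝ y v * g y)) x *
        laplaceTransform μ c g x := by
  have hg1 := hg.inner_mul c v
  have hg2 := hg1.inner_mul c v
  set L := laplaceTransform μ c g x with hL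
  set L' := laplaceTransform μ c (fun y => c * inner ℝ y v * g y) x with hL'
  set L'' := laplaceTransform μ c (fun y => c * inner ℝ y v * (c * inner ℝ y v * g y)) x with hL''
  have key (s : ℝ) : 0 ≤ L'' - 2 * s * L' + s ^ 2 * L := by
    have h : L'' - 2 * s * L' + s ^ 2 * L =
        ∫ y, Real.exp (c * inner ℝ y x) * ((c * inner ℝ y v - s) ^ 2 * g y) ∂μ := by
      simp only [hL, hL', hL'', laplaceTransform]
      have hsub : Integrable (fun y => Real.exp (c * inner ℝ y x) •
          (c * inner ℝ y v * (c * inner ℝ y v * g y)) -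
          2 * s * Real.exp (c * inner ℝ y x) • (c * inner ℝ y v * g y)) μ :=
        (hg2.integrable c x).sub ((hg1.integrable c x).const_mul _)
      rw [← integral_const_mul, ← integral_const_mul, ← integral_sub (hg2.integrable c x)
        ((hg1.integrable c x).const_mul _), ← integral_add hsub
        ((hg.integrable c x).const_mul _)]
      refine integral_congr_ae (.of_forall fun y => ?_)
      simp only [smul_eq_mul]
      ring
    rw [h]
    exact integral_nonneg fun y =>
      mul_nonneg (Real.exp_pos _).le (mul_nonneg (sq_nonneg _) (hg0 y))
  have h := mul_nonneg (key (L' / L)) hpos.le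
  have h2 : (L'' - 2 * (L' / L) * L' + (L' / L) ^ 2 * L) * L = L'' * L - L' ^ 2 := by
    field_simp
    ring
  linarith

end LaplaceTransform

section GaussianFactor

variable {E : Type} [NormedAddCommGroup E] [InnerProductSpace ℝ E]

lemma hasFDerivAt_exp_neg_mul_sq (b : ℝ) (x : E) :
    HasFDerivAt (fun z : E => Real.exp (-b * ‖z‖ ^ 2))
      (Real.exp (-b * ‖x‖ ^ 2) • (-b) • (2 : ℕ) • innerSL ℝ x) x :=
  ((hasStrictFDerivAt_norm_sq x).hasFDerivAt.const_mul (-b)).exp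

lemma fderiv_exp_mul_apply {b : ℝ} {h : E → ℝ} {x : E} (hh : DifferentiableAt ℝ h x) (v : E) :
    fderiv ℝ (fun z => Real.exp (-b * ‖z‖ ^ 2) * h z) x v =
      Real.exp (-b * ‖x‖ ^ 2) * (fderiv ℝ h x v - 2 * b * inner ℝ x v * h x) := by
  rw [((hasFDerivAt_exp_neg_mul_sq b x).fun_mul hh.hasFDerivAt).fderiv]
  simp
  ring

lemma iteratedFDeriv_two_exp_mul {b : ℝ} {h : E → ℝ} (hh : ContDiff ℝ 2 h) (x v : E) :
    iteratedFDeriv ℝ 2 (fun z => Real.exp (-b * ‖z‖ ^ 2) * h z) x ![v, v] =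
      Real.exp (-b * ‖x‖ ^ 2) *
        (fderiv ℝ (fun z => fderiv ℝ h z v) x v - 4 * b * inner ℝ x v * fderiv ℝ h x v
          - 2 * b * ‖v‖ ^ 2 * h x + (2 * b * inner ℝ x v) ^ 2 * h x) := by
  have hsm : ContDiff ℝ 2 (fun z => Real.exp (-b * ‖z‖ ^ 2) * h z) :=
    (ContDiff.exp (contDiff_const.mul (contDiff_norm_sq ℝ))).mul hh
  have hd : Differentiable ℝ h := hh.differentiable (by norm_num)
  have hd' : Differentiable ℝ (fun z => fderiv ℝ h z v) := fun z =>
    ((hh.fderiv_right (m := 1) (by norm_num)).differentiable (by norm_num) z).clm_apply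
      (differentiableAt_const v)
  have hdd : DifferentiableAt ℝ (fderiv ℝ (fun z => Real.exp (-b * ‖z‖ ^ 2) * h z)) x :=
    (hsm.fderiv_right (m := 1) (by norm_num)).differentiable (by norm_num) x
  have hswap : fderiv ℝ (fderiv ℝ (fun z => Real.exp (-b * ‖z‖ ^ 2) * h z)) x v v =
      fderiv ℝ (fun z => fderiv ℝ (fun z => Real.exp (-b * ‖z‖ ^ 2) * h z) z v) x v := by
    rw [fderiv_clm_apply hdd (differentiableAt_const v)]
    simp
  have hin : HasFDerivAt (fun z : E => inner ℝ z v) (innerSL ℝ v) x :=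
    (innerSL ℝ v).hasFDerivAt.congr_of_eventuallyEq (.of_forall fun z => real_inner_comm v z)
  have hinner : HasFDerivAt (fun z => fderiv ℝ h z v - 2 * b * inner ℝ z v * h z) _ x :=
    (hd' x).hasFDerivAt.fun_sub ((hin.const_mul (2 * b)).fun_mul (hd x).hasFDerivAt)
  simp only [iteratedFDeriv_two_apply, Matrix.cons_val_zero, Matrix.cons_val_one]
  rw [hswap]
  simp_rw [fun z => fderiv_exp_mul_apply (b := b) (hd z) v]
  rw [fderiv_exp_mul_apply hinner.differentiableAt v, hinner.fderiv]
  simp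
  ring

end GaussianFactor

lemma expIntegrable_gaussian_mul {n : ℕ} {f : EuclideanSpace ℝ (Fin n) → ℝ}
    (hmeas : Measurable f) {M : ℝ} (hbd : ∀ y, |f y| ≤ M) {b : ℝ} (hb : 0 < b) :
    ExpIntegrable volume (fun y => Real.exp (-b * ‖y‖ ^ 2) * f y) := by
  have hm : Measurable (fun y => Real.exp (-b * ‖y‖ ^ 2) * f y) := by fun_prop
  refine ⟨hm.aestronglyMeasurable, fun R => ?_⟩
  have hgauss : Integrable (fun y : EuclideanSpace ℝ (Fin n) => Real.exp (-(b / 2) * ‖y‖ ^ 2)) := by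
    have := (GaussianFourier.integrable_cexp_neg_mul_sq_norm_add (b := ((b / 2 : ℝ) : ℂ))
      (by simpa using hb) 0 (0 : EuclideanSpace ℝ (Fin n))).norm
    simpa [Complex.norm_exp, ← Complex.ofReal_pow] using this
  refine (hgauss.const_mul (Real.exp (R ^ 2 / (2 * b)) * M)).mono'
    (by fun_prop) (.of_forall fun y => ?_)
  rw [norm_mul, norm_norm, norm_mul, Real.norm_of_nonneg (Real.exp_pos _).le,
    Real.norm_of_nonneg (Real.exp_pos _).le, Real.norm_eq_abs, ← mul_assoc, ← Real.exp_add,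
    mul_right_comm, ← Real.exp_add]
  refine mul_le_mul (Real.exp_le_exp.2 ?_) (hbd y) (abs_nonneg _) (Real.exp_pos _).le
  have : R ^ 2 / (2 * b) + -(b / 2) * ‖y‖ ^ 2 - (R * ‖y‖ + -b * ‖y‖ ^ 2)
      = (R - b * ‖y‖) ^ 2 / (2 * b) := by
    field_simp
    ring
  have : 0 ≤ (R - b * ‖y‖) ^ 2 / (2 * b) := by positivity
  linarith

/-- Expanding the square in the heat kernel writes the heat flow as a Gaussian times a Laplace
transform. -/
lemma heatFlow_eq (n : ℕ) (f : EuclideanSpace ℝ (Fin n) → ℝ) {t : ℝ} (ht : 0 < t) :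
    heatFlow n f t = fun x => Real.exp (-(1 / (4 * t)) * ‖x‖ ^ 2) *
      ((4 * Real.pi * t) ^ (-(n : ℝ) / 2) * laplaceTransform volume (1 / (2 * t))
        (fun y => Real.exp (-(1 / (4 * t)) * ‖y‖ ^ 2) * f y) x) := by
  funext x
  rw [heatFlow, laplaceTransform, ← integral_const_mul, ← integral_const_mul]
  refine integral_congr_ae (.of_forall fun y => ?_)
  have h : Real.exp (-‖x - y‖ ^ 2 / (4 * t)) = Real.exp (-(1 / (4 * t)) * ‖x‖ ^ 2) *
      (Real.exp (1 / (2 * t) * inner ℝ y x) * Real.exp (-(1 / (4 * t)) * ‖y‖ ^ 2)) := by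
    rw [← Real.exp_add, ← Real.exp_add, norm_sub_sq_real, real_inner_comm]
    congr 1
    field_simp
    ring
  simp only [h, smul_eq_mul]
  ring

/-- For bounded measurable `f ≥ 0`, not a.e. zero, the heat flow `f_t` is smooth
and positive and satisfies the Li–Yau differential Harnack inequality
`Δf_t/f_t − ‖∇f_t‖²/f_t² + n/(2t) ≥ 0`. -/
theorem li_yau_harnack_heat_flow
    (n : ℕ) (hn : 1 ≤ n) (f : EuclideanSpace ℝ (Fin n) → ℝ)
    (hmeas : Measurable f) (hnonneg : ∀ y, 0 ≤ f y)
    (M : ℝ) (hbd : ∀ y, f y ≤ M)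
    (hne : ¬ (f =ᵐ[MeasureTheory.volume] 0)) :
    ∀ t > 0, ContDiff ℝ (⊤ : ℕ∞) (heatFlow n f t) ∧
      (∀ x, 0 < heatFlow n f t x) ∧
      ∀ x : EuclideanSpace ℝ (Fin n),
        0 ≤ laplacian n (heatFlow n f t) x / heatFlow n f t x
          - ‖gradient (heatFlow n f t) x‖ ^ 2 / (heatFlow n f t x) ^ 2
          + (n : ℝ) / (2 * t) := by
  intro t ht
  set b : ℝ := 1 / (4 * t) with hb
  set c : ℝ := 1 / (2 * t) with hc
  have hb0 : 0 < b := by positivity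
  have hbc : 2 * b = c := by rw [hb, hc]; field_simp; norm_num
  set K : ℝ := (4 * Real.pi * t) ^ (-(n : ℝ) / 2) with hK
  have hK0 : 0 < K := Real.rpow_pos_of_pos (by positivity) _
  set g : EuclideanSpace ℝ (Fin n) → ℝ := fun y => Real.exp (-b * ‖y‖ ^ 2) * f y with hg_def
  have hg0 (y) : 0 ≤ g y := mul_nonneg (Real.exp_pos _).le (hnonneg y)
  have hg : ExpIntegrable volume g :=
    expIntegrable_gaussian_mul hmeas (fun y => (abs_of_nonneg (hnonneg y)).trans_le (hbd y)) hb0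
  have hflow : heatFlow n f t = fun x => Real.exp (-b * ‖x‖ ^ 2) *
      (K * laplaceTransform volume c g x) := heatFlow_eq n f ht
  have hLpos (x) : 0 < laplaceTransform volume c g x := by
    refine (integral_pos_iff_support_of_nonneg
      (fun y => mul_nonneg (Real.exp_pos _).le (hg0 y)) (hg.integrable c x)).2 ?_
    have hsupp : Function.support (fun y => Real.exp (c * inner ℝ y x) • g y) = {y | f y ≠ 0} := by
      ext y
      simp [hg_def]
    simp only [smul_eq_mul] at hsupp ⊢
    rw [hsupp]
    exact pos_iff_ne_zero.2 fun h => hne (ae_iff.2 h)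
  have hLsm := hg.contDiff_laplaceTransform c
  have hLsm2 : ContDiff ℝ 2 (fun x => K * laplaceTransform volume c g x) :=
    contDiff_const.mul (contDiff_infty.1 hLsm 2)
  have hpos (x) : 0 < heatFlow n f t x := by
    rw [hflow]
    exact mul_pos (Real.exp_pos _) (mul_pos hK0 (hLpos x))
  refine ⟨?_, hpos, fun x => ?_⟩
  · rw [hflow]
    exact (ContDiff.exp (contDiff_const.mul (contDiff_norm_sq ℝ))).mul (contDiff_const.mul hLsm)
  have hgrad : ‖gradient (heatFlow n f t) x‖ ^ 2 =
      ∑ i, fderiv ℝ (heatFlow n f t) x (EuclideanSpace.single i 1) ^ 2 := by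
    rw [EuclideanSpace.real_norm_sq_eq]
    refine Finset.sum_congr rfl fun i _ => ?_
    rw [← inner_gradient_left, EuclideanSpace.inner_single_right]
    simp
  have hdir (i : Fin n) : fderiv ℝ (heatFlow n f t) x (EuclideanSpace.single i 1) ^ 2 ≤
      iteratedFDeriv ℝ 2 (heatFlow n f t) x
          ![EuclideanSpace.single i (1 : ℝ), EuclideanSpace.single i (1 : ℝ)] * heatFlow n f t x
        + c * heatFlow n f t x ^ 2 := by
    set v : EuclideanSpace ℝ (Fin n) := EuclideanSpace.single i 1 with hv
    have hd1 (z) : fderiv ℝ (fun x => K * laplaceTransform volume c g x) z v =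
        K * laplaceTransform volume c (fun y => c * inner ℝ y v * g y) z := by
      rw [fderiv_const_mul (hg.hasFDerivAt_laplaceTransform c z).differentiableAt,
        ← hg.fderiv_laplaceTransform_apply]
      rfl
    have hd2 : fderiv ℝ (fun z => K * laplaceTransform volume c
          (fun y => c * inner ℝ y v * g y) z) x v =
        K * laplaceTransform volume c (fun y => c * inner ℝ y v * (c * inner ℝ y v * g y)) x := by
      rw [fderiv_const_mul ((hg.inner_mul c v).hasFDerivAt_laplaceTransform c x).differentiableAt,
        ← (hg.inner_mul c v).fderiv_laplaceTransform_apply]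
      rfl
    have hCS := hg.sq_laplaceTransform_le hg0 c x v (hLpos x)
    have hvn : ‖v‖ = 1 := by simp [hv]
    rw [hflow, iteratedFDeriv_two_exp_mul hLsm2,
      fderiv_exp_mul_apply (hLsm2.differentiable (by norm_num) x)]
    simp_rw [hd1]
    rw [hd2, hvn, ← hbc]
    rw [← hbc] at hCS
    have := mul_le_mul_of_nonneg_left hCS (sq_nonneg (Real.exp (-b * ‖x‖ ^ 2) * K))
    linarith
  have hsum := Finset.sum_le_sum fun i (_ : i ∈ Finset.univ) => hdir i
  rw [← hgrad, Finset.sum_add_distrib, ← Finset.sum_mul] at hsum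
  simp only [Finset.sum_const, Finset.card_univ, Fintype.card_fin, nsmul_eq_mul] at hsum
  change _ ≤ laplacian n (heatFlow n f t) x * _ + _ at hsum
  have hu := hpos x
  have heq : laplacian n (heatFlow n f t) x / heatFlow n f t x
      - ‖gradient (heatFlow n f t) x‖ ^ 2 / (heatFlow n f t x) ^ 2 + (n : ℝ) / (2 * t) =
      (laplacian n (heatFlow n f t) x * heatFlow n f t x + n * (c * heatFlow n f t x ^ 2)
        - ‖gradient (heatFlow n f t) x‖ ^ 2) / heatFlow n f t x ^ 2 := by
    rw [hc]
    field_simp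
    ring
  rw [heq]
  exact div_nonneg (by linarith) (sq_nonneg _)
end
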